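/- arXiv:1808.10107 — 3 statements merged into one kernel-verified Lean document; each statement's English description precedes it below -/
import Mathlib

section
/- Let n ≥ 5, let G be the symmetric group on n letters, and let H be a subgroup of G such that there is a surjective group homomorphism from H onto the alternating group on m letters, where m = n or m = n − 1. Then H is isomorphic to the alternating group on m letters. -/
open Equiv in
/-- In a symmetric group of degree at least four, the only permutation fixing `p` and commuting
with the whole stabilizer of `p` is the identity. -/
theorem perm_eq_one_of_forall_stabilizer_commute {α : Type*} [Finite α] (hα : 4 ≤ Nat.card α)
    {p : α} {c : Perm α} (hp : c p = p) (hc : ∀ τ : Perm α, τ p = p → Commute c τ) : c = 1 := by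
  classical
  have := Fintype.ofFinite α
  by_contra hne
  obtain ⟨q, hq⟩ : ∃ q, c q ≠ q := by
    by_contra! h
    exact hne (Equiv.ext h)
  have hqp : q ≠ p := by
    rintro rfl
    exact hq hp
  have hrp : c q ≠ p := fun h => hqp (c.injective (h.trans hp.symm))
  obtain ⟨s, hs⟩ : ∃ s, s ∉ ({p, q, c q} : Finset α) := by
    by_contra! h
    have hle := (Finset.card_le_card (fun x _ => h x : Finset.univ ⊆ _)).trans
      Finset.card_le_three
    rw [Finset.card_univ, ← Nat.card_eq_fintype_card] at hle
    omega
  simp only [Finset.mem_insert, Finset.mem_singleton, not_or] at hs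
  obtain ⟨hsp, hsq, hsr⟩ := hs
  have h := congrArg (· q) (hc (swap (c q) s) (swap_apply_of_ne_of_ne hrp.symm (Ne.symm hsp))).eq
  simp only [Perm.mul_apply, swap_apply_left, swap_apply_of_ne_of_ne hq.symm (Ne.symm hsq)] at h
  exact hsr h.symm

/-- A normal subgroup of order two is central. -/
theorem Subgroup.Normal.le_center_of_card_eq_two {G : Type*} [Group G] {K : Subgroup G}
    (hK : K.Normal) (h2 : Nat.card K = 2) : K ≤ Subgroup.center G := by
  intro c hc
  rw [Subgroup.mem_center_iff]
  intro g
  by_cases h1 : c = 1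
  · simp [h1]
  obtain ⟨x, y, -, hxy⟩ := Nat.card_eq_two_iff.mp h2
  have hmem : ∀ z : K, z = x ∨ z = y := fun z => by
    have : z ∈ ({x, y} : Set K) := hxy ▸ Set.mem_univ z
    simpa using this
  have h3 : g * c * g⁻¹ ≠ 1 := by simpa using h1
  have := hmem 1
  have := hmem ⟨c, hc⟩
  have := hmem ⟨g * c * g⁻¹, hK.conj_mem c hc g⟩
  have hval : (⟨g * c * g⁻¹, hK.conj_mem c hc g⟩ : K) = ⟨c, hc⟩ := by
    have : (⟨c, hc⟩ : K) ≠ 1 := by simpa [Subtype.ext_iff] using h1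
    have : (⟨g * c * g⁻¹, hK.conj_mem c hc g⟩ : K) ≠ 1 := by simpa [Subtype.ext_iff] using h3
    grind
  exact mul_inv_eq_iff_eq_mul.mp (congrArg Subtype.val hval)

/-- A surjective homomorphism from a subgroup of a symmetric group containing the alternating
group to a finite group of order greater than two is injective. -/
theorem injective_of_alternatingGroup_le {α : Type*} [Fintype α] [DecidableEq α]
    (hα : 5 ≤ Nat.card α) {H : Subgroup (Equiv.Perm α)} (hH : alternatingGroup α ≤ H)
    {A : Type*} [Group A] (hA : 2 < Nat.card A) (f : H →* A)
    (hf : Function.Surjective f) : Function.Injective f := by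
  have : Nontrivial α := Finite.one_lt_card_iff_nontrivial.mp (by omega)
  have hdvd : H.index ∣ 2 := alternatingGroup.index_eq_two (α := α) ▸ Subgroup.index_dvd_of_le hH
  rcases (Nat.dvd_prime Nat.prime_two).mp hdvd with h | h
  · obtain rfl := Subgroup.index_eq_one.mp h
    let g : Equiv.Perm α →* A := f.comp Subgroup.topEquiv.symm.toMonoidHom
    have hg : Function.Surjective g := hf.comp Subgroup.topEquiv.symm.surjective
    have hgi : Function.Injective g := by
      rw [← MonoidHom.ker_eq_bot_iff]
      by_contra hne
      have hle := Equiv.Perm.alternatingGroup_le_of_normal hα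
        (g.ker.nontrivial_iff_ne_bot.mpr hne)
      have hd := Subgroup.index_dvd_of_le hle
      rw [alternatingGroup.index_eq_two, Subgroup.index_ker, MonoidHom.range_eq_top.mpr hg,
        Subgroup.card_top] at hd
      exact absurd (Nat.le_of_dvd two_pos hd) (by omega)
    exact hgi.comp Subgroup.topEquiv.injective
  · obtain rfl := Equiv.Perm.eq_alternatingGroup_of_index_eq_two h
    have := alternatingGroup.isSimpleGroup hα
    rcases f.normal_ker.eq_bot_or_eq_top with hk | hk
    · exact (MonoidHom.ker_eq_bot_iff f).mp hk
    · have hc := Subgroup.index_ker f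
      rw [hk, Subgroup.index_top, MonoidHom.range_eq_top.mpr hf, Subgroup.card_top] at hc
      omega

/-- A core-free subgroup of a symmetric group has index at least the degree. -/
theorem card_le_index_of_normalCore_eq_bot {α : Type*} [Finite α]
    {H : Subgroup (Equiv.Perm α)} (hH : H.normalCore = ⊥) : Nat.card α ≤ H.index := by
  rw [Subgroup.normalCore_eq_ker, MonoidHom.ker_eq_bot_iff] at hH
  have hle := Nat.card_le_card_of_injective _ hH
  rw [Nat.card_perm, Nat.card_perm, ← Subgroup.index_eq_card] at hle
  by_contra! hlt
  exact hle.not_gt (Nat.factorial_lt_of_lt Subgroup.index_ne_zero_of_finite.bot_lt hlt)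

/-- A core-free subgroup of `Perm α` whose index is the degree has no normal subgroup
of order two. -/
theorem card_ne_two_of_normalCore_eq_bot {α : Type*} [Finite α] (hα : 4 ≤ Nat.card α)
    {H : Subgroup (Equiv.Perm α)} (hH : H.normalCore = ⊥) (hi : H.index = Nat.card α)
    {K : Subgroup H} (hK : K.Normal) : Nat.card K ≠ 2 := by
  intro h2
  rw [Subgroup.normalCore_eq_ker, MonoidHom.ker_eq_bot_iff] at hH
  have hcard : Nat.card (Equiv.Perm α ⧸ H) = Nat.card α := by rw [← Subgroup.index_eq_card, hi]
  have hbij := hH.bijective_of_nat_card_le (by rw [Nat.card_perm, Nat.card_perm, hcard])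
  have hfix : ∀ g : Equiv.Perm α, MulAction.toPermHom _ (Equiv.Perm α ⧸ H) g
      ((1 : Equiv.Perm α) : Equiv.Perm α ⧸ H) = ((1 : Equiv.Perm α) : Equiv.Perm α ⧸ H) ↔
      g ∈ H := by
    intro g
    rw [MulAction.toPermHom_apply, MulAction.toPerm_apply, ← MulAction.mem_stabilizer_iff,
      MulAction.stabilizer_quotient]
  refine absurd h2 (ne_of_eq_of_ne (Subgroup.card_eq_one.mpr ?_) (by norm_num))
  rw [Subgroup.eq_bot_iff_forall]
  intro c hc
  have hcc := Subgroup.mem_center_iff.mp (hK.le_center_of_card_eq_two h2 hc)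
  have := perm_eq_one_of_forall_stabilizer_commute (by omega) ((hfix c).mpr c.2) fun τ hτ => by
    obtain ⟨g, rfl⟩ := hbij.2 τ
    have hg := (hfix g).mp hτ
    have : Commute (c : Equiv.Perm α) g := (congrArg Subtype.val (hcc ⟨g, hg⟩)).symm
    exact this.map _
  exact Subtype.ext (hH (this.trans (map_one _).symm))

/-- If `n ≥ 5` and a subgroup `H` of `Sym_n` has `Alt_m` (`m = n` or `m = n - 1`) as a
homomorphic image, then `H ≅ Alt_m`. -/
theorem subgroup_of_sym_with_alt_image (n m : ℕ) (hn : 5 ≤ n) (hm : m = n ∨ m = n - 1)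
    (H : Subgroup (Equiv.Perm (Fin n)))
    (f : H →* alternatingGroup (Fin m)) (hf : Function.Surjective f) :
    Nonempty (H ≃* alternatingGroup (Fin m)) := by
  suffices h : Function.Injective f from ⟨MulEquiv.ofBijective f ⟨h, hf⟩⟩
  have : Nontrivial (Fin m) := Fin.nontrivial_iff_two_le.mpr (by omega)
  have hA : 2 * Nat.card (alternatingGroup (Fin m)) = m.factorial := by
    rw [two_mul_nat_card_alternatingGroup, Nat.card_perm, Nat.card_fin]
  by_cases hcore : H.normalCore = ⊥
  · have hle := card_le_index_of_normalCore_eq_bot hcore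
    rw [Nat.card_fin] at hle
    have hker := f.ker.card_mul_index
    rw [Subgroup.index_ker, MonoidHom.range_eq_top.mpr hf, Subgroup.card_top] at hker
    have hcard := H.card_mul_index
    rw [← hker, Nat.card_perm, Nat.card_fin] at hcard
    have hpos : 0 < Nat.card f.ker := Nat.card_pos
    have hprod : (Nat.card f.ker * H.index) * m.factorial = 2 * n.factorial := by
      rw [← hA, ← hcard]; ring
    rw [← MonoidHom.ker_eq_bot_iff, ← Subgroup.card_eq_one]
    rcases hm with rfl | rfl
    · have := Nat.eq_of_mul_eq_mul_right (Nat.factorial_pos _) hprod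
      nlinarith
    · rw [← Nat.mul_factorial_pred (by omega : n ≠ 0), ← mul_assoc] at hprod
      have hkd := Nat.eq_of_mul_eq_mul_right (Nat.factorial_pos _) hprod
      have hk : Nat.card f.ker ≤ 2 := by
        by_contra! h
        nlinarith
      by_contra hne
      have h2 : Nat.card f.ker = 2 := by omega
      rw [h2] at hkd
      exact card_ne_two_of_normalCore_eq_bot (by simp; omega) hcore (by simp; omega)
        f.normal_ker h2
  · refine injective_of_alternatingGroup_le (by simpa using hn)
      ((Equiv.Perm.alternatingGroup_le_of_normal (by simpa using hn)
        ((Subgroup.nontrivial_iff_ne_bot _).mpr hcore)).trans H.normalCore_le) ?_ f hf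
    have := Nat.factorial_le (by omega : 4 ≤ m)
    have : Nat.factorial 4 = 24 := rfl
    omega
end

section
/- Let q > 1 and n be positive integers, let r be an odd prime with gcd(q, r) = 1, and let e = e(q, r). Then ∏_{i=1}^{n} (q^i − 1)_r = (q^e − 1)_r^{⌊n/e⌋} · (⌊n/e⌋!)_r. -/
/-- The `r`-part of a natural number: `r ^ v_r(m)`. -/
def rPart (r m : ℕ) : ℕ := r ^ (m.factorization r)

/-- The `r`-part of an integer: `r ^ v_r(m)`. -/
def rPartZ (r : ℕ) (m : ℤ) : ℤ := (r : ℤ) ^ (m.natAbs.factorization r)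

/-- `e* = 2e` if `e` is odd, `e* = e` if `e ≡ 0 (mod 4)`, and `e* = e / 2` if `e ≡ 2 (mod 4)`. -/
def estar (e : ℕ) : ℕ := if e % 2 = 1 then 2 * e else if e % 4 = 0 then e else e / 2

theorem rPart_mul (r : ℕ) {a b : ℕ} (ha : a ≠ 0) (hb : b ≠ 0) :
    rPart r (a * b) = rPart r a * rPart r b := by
  simp [rPart, Nat.factorization_mul ha hb, pow_add]

theorem rPart_eq_one_of_not_dvd {r m : ℕ} (h : ¬ r ∣ m) : rPart r m = 1 := by
  simp [rPart, Nat.factorization_eq_zero_of_not_dvd h]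

theorem dvd_pow_sub_one_iff_orderOf_dvd {q : ℕ} (r i : ℕ) (hq : 0 < q) :
    r ∣ q ^ i - 1 ↔ orderOf (q : ZMod r) ∣ i := by
  rw [orderOf_dvd_iff_pow_eq_one, ← ZMod.natCast_eq_zero_iff,
    Nat.cast_sub (Nat.one_le_pow i q hq), Nat.cast_pow, Nat.cast_one, sub_eq_zero]

/-- Lifting the exponent, in terms of `r`-parts. -/
theorem rPart_pow_sub_one {r x k : ℕ} (hr : r.Prime) (hodd : Odd r) (hx : 1 < x)
    (hdvd : r ∣ x - 1) (hndvd : ¬ r ∣ x) (hk : k ≠ 0) :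
    rPart r (x ^ k - 1) = rPart r (x - 1) * rPart r k := by
  have : Fact r.Prime := ⟨hr⟩
  have h := padicValNat.pow_sub_pow hodd hx hdvd hndvd hk
  rw [one_pow] at h
  simp only [rPart, Nat.factorization_def _ hr, h, pow_add]

/-- `∏_{i=1}^{n} (q^i − 1)_r = (q^e − 1)_r^{⌊n/e⌋} ⬝ (⌊n/e⌋!)_r`, where `e = e(q, r)` is
the multiplicative order of `q` mod `r`. -/
theorem prod_rPart_pow_sub_one (q n r : ℕ) (hq : 1 < q) (hn : 0 < n)
    (hr : r.Prime) (hodd : Odd r) (hdvd : ¬ r ∣ q) :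
    (∏ i ∈ Finset.Icc 1 n, rPart r (q ^ i - 1)) =
      rPart r (q ^ orderOf (q : ZMod r) - 1) ^ (n / orderOf (q : ZMod r)) *
        rPart r (Nat.factorial (n / orderOf (q : ZMod r))) := by
  clear hn
  have hdvd_iff := fun i => dvd_pow_sub_one_iff_orderOf_dvd r i (Nat.zero_lt_of_lt hq)
  have : Fact r.Prime := ⟨hr⟩
  have he : orderOf (q : ZMod r) ≠ 0 := by
    have hq0 : (q : ZMod r) ≠ 0 := by rwa [Ne, ZMod.natCast_eq_zero_iff]
    exact (orderOf_pos_iff.mpr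
      (isOfFinOrder_iff_pow_eq_one.mpr
        ⟨r - 1, Nat.sub_pos_of_lt hr.one_lt, ZMod.pow_card_sub_one_eq_one hq0⟩)).ne'
  generalize orderOf (q : ZMod r) = e at *
  induction n with
  | zero => simp [rPart]
  | succ n ih =>
    rw [Finset.prod_Icc_succ_top (Nat.le_add_left 1 n), ih, Nat.succ_div]
    split_ifs with h
    · have hk : (n + 1) / e = n / e + 1 := by rw [Nat.succ_div, if_pos h]
      have hpow : q ^ (n + 1) = (q ^ e) ^ (n / e + 1) := by
        rw [← pow_mul, ← hk, Nat.mul_div_cancel' h]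
      rw [hpow, rPart_pow_sub_one hr hodd (Nat.one_lt_pow he hq) ((hdvd_iff e).mpr dvd_rfl)
        (fun h' => hdvd (hr.dvd_of_dvd_pow h')) (Nat.succ_ne_zero _), Nat.factorial_succ,
        rPart_mul r (Nat.succ_ne_zero _) (Nat.factorial_ne_zero _), pow_succ]
      ring
    · rw [rPart_eq_one_of_not_dvd (mt (hdvd_iff _).mp h), mul_one, add_zero]
end

section
/- Let q > 1 and n be positive integers, let r be an odd prime with gcd(q, r) = 1, let e = e(q, r) and let e* be as defined. Then ∏_{i=1}^{n} (q^i − (−1)^i)_r = (q^{e*} − (−1)^{e*})_r^{⌊n/e*⌋} · (⌊n/e*⌋!)_r. -/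
/-- Arithmetic form of: `-a` has order `estar e` when `a` has order `e`. -/
theorem estar_dvd_iff {e i : ℕ} :
    estar e ∣ i ↔ (Even i ∧ e ∣ i) ∨ (Odd i ∧ e ∣ 2 * i ∧ ¬ e ∣ i) := by
  unfold estar
  split_ifs with h1 h2
  · have hcop : Nat.Coprime 2 e := (Nat.coprime_two_left).2 (Nat.odd_iff.2 h1)
    constructor
    · intro h
      exact Or.inl ⟨even_iff_two_dvd.2 ((dvd_mul_right _ _).trans h), (dvd_mul_left _ _).trans h⟩
    · rintro (⟨h, h'⟩ | ⟨-, h, h'⟩)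
      · exact hcop.mul_dvd_of_dvd_of_dvd (even_iff_two_dvd.1 h) h'
      · exact absurd (hcop.symm.dvd_of_dvd_mul_left h) h'
  · have h4 : 4 ∣ e := Nat.dvd_of_mod_eq_zero h2
    constructor
    · intro h
      exact Or.inl ⟨even_iff_two_dvd.2 ((Dvd.dvd.trans (by norm_num) h4).trans h), h⟩
    · rintro (⟨-, h⟩ | ⟨hi, h, -⟩)
      · exact h
      · have := h4.trans h
        rw [Nat.odd_iff] at hi
        omega
  · obtain ⟨k, rfl⟩ : ∃ k, e = 2 * k := ⟨e / 2, by omega⟩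
    have hk : Odd k := Nat.odd_iff.2 (by omega)
    rw [Nat.mul_div_cancel_left k two_pos, Nat.mul_dvd_mul_iff_left two_pos]
    have hcop : Nat.Coprime 2 k := Nat.coprime_two_left.2 hk
    constructor
    · intro h
      rcases Nat.even_or_odd i with hi | hi
      · exact Or.inl ⟨hi, hcop.mul_dvd_of_dvd_of_dvd (even_iff_two_dvd.1 hi) h⟩
      · refine Or.inr ⟨hi, h, fun h' => ?_⟩
        exact Nat.not_even_iff_odd.2 hi (even_iff_two_dvd.2 ((dvd_mul_right _ _).trans h'))
    · rintro (⟨-, h⟩ | ⟨-, h, -⟩)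
      · exact (dvd_mul_left _ _).trans h
      · exact h

theorem pow_eq_neg_one_pow_iff_estar_dvd {K : Type*} [Field K] (h2 : (-1 : K) ≠ 1) (a : K)
    (i : ℕ) : a ^ i = (-1) ^ i ↔ estar (orderOf a) ∣ i := by
  rw [estar_dvd_iff, orderOf_dvd_iff_pow_eq_one, orderOf_dvd_iff_pow_eq_one]
  rcases Nat.even_or_odd i with hi | hi
  · simp [hi, hi.neg_one_pow]
  · have hne : ¬ Even i := Nat.not_even_iff_odd.2 hi
    rw [hi.neg_one_pow, mul_comm 2 i, pow_mul, sq_eq_one_iff]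
    constructor
    · intro h
      exact Or.inr ⟨hi, Or.inr h, by rwa [h]⟩
    · rintro (⟨h, -⟩ | ⟨-, h, h'⟩)
      · exact absurd h hne
      · exact h.resolve_left h'

theorem dvd_pow_sub_neg_one_pow_iff {q r : ℕ} (hr : r.Prime) (hodd : Odd r) (i : ℕ) :
    (r : ℤ) ∣ (q : ℤ) ^ i - (-1) ^ i ↔ estar (orderOf (q : ZMod r)) ∣ i := by
  have := Fact.mk hr
  have : Fact (2 < r) := ⟨by
    have := hr.two_le
    rw [Nat.odd_iff] at hodd
    omega⟩
  rw [← pow_eq_neg_one_pow_iff_estar_dvd (ZMod.neg_one_ne_one), ← ZMod.intCast_zmod_eq_zero_iff_dvd]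
  push_cast
  exact sub_eq_zero

theorem pow_sub_neg_one_pow_ne_zero {q i : ℕ} (hq : 1 < q) (hi : i ≠ 0) :
    (q : ℤ) ^ i - (-1) ^ i ≠ 0 := by
  have h : (1 : ℤ) < (q : ℤ) ^ i := one_lt_pow₀ (by exact_mod_cast hq) hi
  rcases neg_one_pow_eq_or ℤ i with h' | h' <;> rw [h'] <;> omega

theorem rPartZ_eq_one_of_not_dvd {r : ℕ} {m : ℤ} (h : ¬ (r : ℤ) ∣ m) : rPartZ r m = 1 := by
  rw [rPartZ, Nat.factorization_eq_zero_of_not_dvd (by rwa [← Int.natCast_dvd]), pow_zero]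

theorem rPartZ_mul (r : ℕ) {a b : ℤ} (ha : a ≠ 0) (hb : b ≠ 0) :
    rPartZ r (a * b) = rPartZ r a * rPartZ r b := by
  rw [rPartZ, Int.natAbs_mul,
    Nat.factorization_mul (Int.natAbs_ne_zero.2 ha) (Int.natAbs_ne_zero.2 hb), Finsupp.add_apply,
    pow_add, rPartZ, rPartZ]

/-- Lifting the exponent, in terms of `r`-parts. -/
theorem rPartZ_pow_sub_pow {r : ℕ} (hr : r.Prime) (hodd : Odd r) {x y : ℤ}
    (hxy : (r : ℤ) ∣ x - y) (hx : ¬ (r : ℤ) ∣ x) {m : ℕ} (hm : m ≠ 0) (h0 : x ^ m - y ^ m ≠ 0) :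
    rPartZ r (x ^ m - y ^ m) = rPartZ r (x - y) * rPartZ r m := by
  have h1 : x - y ≠ 0 := fun h => h0 (by rw [sub_eq_zero.1 h, sub_self])
  have hmul := Int.emultiplicity_pow_sub_pow hr hodd hxy hx m
  have key : ∀ {z : ℤ}, z ≠ 0 → emultiplicity (r : ℤ) z = (z.natAbs.factorization r : ℕ∞) := by
    intro z hz
    rw [← Int.natAbs_ne_zero] at hz
    have := Fact.mk hr
    rw [Nat.factorization_def _ hr, padicValNat_eq_emultiplicity hz, ← Int.natCast_emultiplicity]
    exact emultiplicity_eq_of_associated_right (Int.associated_natAbs z)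
  rw [← Int.natCast_emultiplicity, key h0, key h1, key (by exact_mod_cast hm)] at hmul
  rw [rPartZ, rPartZ, rPartZ, ← pow_add]
  congr 1
  exact_mod_cast hmul

/-- `∏_{i=1}^{n} (q^i − (−1)^i)_r = (q^{e*} − (−1)^{e*})_r^{⌊n/e*⌋} ⬝ (⌊n/e*⌋!)_r`,
where `e = e(q, r)` is the multiplicative order of `q` mod `r`. -/
theorem prod_rPartZ_pow_sub_neg_one (q n r : ℕ) (hq : 1 < q) (hn : 0 < n)
    (hr : r.Prime) (hodd : Odd r) (hdvd : ¬ r ∣ q) :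
    (∏ i ∈ Finset.Icc 1 n, rPartZ r ((q : ℤ) ^ i - (-1) ^ i)) =
      rPartZ r ((q : ℤ) ^ estar (orderOf (q : ZMod r)) -
          (-1) ^ estar (orderOf (q : ZMod r))) ^ (n / estar (orderOf (q : ZMod r))) *
        rPartZ r ((Nat.factorial (n / estar (orderOf (q : ZMod r))) : ℤ)) := by
  set d := estar (orderOf (q : ZMod r)) with hd
  have hdvd_iff := dvd_pow_sub_neg_one_pow_iff (q := q) hr hodd
  rw [← hd] at hdvd_iff
  have hrq : ∀ k, ¬ (r : ℤ) ∣ (q : ℤ) ^ k := fun k h => hdvd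
    (Int.natCast_dvd_natCast.1 ((Nat.prime_iff_prime_int.1 hr).dvd_of_dvd_pow h))
  clear hn
  induction n with
  | zero => simp [rPartZ]
  | succ n ih =>
    rw [Finset.prod_Icc_succ_top (by omega), ih, Nat.succ_div]
    split_ifs with h
    · obtain ⟨m, hm⟩ := id h
      have hm0 : m ≠ 0 := by rintro rfl; simp at hm
      have hd0 : 0 < d := Nat.pos_of_ne_zero (by rintro h0; simp [h0] at hm)
      have hquot : n / d + 1 = m := by
        have := Nat.succ_div (a := n) (b := d)
        rw [if_pos h, hm, Nat.mul_div_cancel_left m hd0] at this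
        exact this.symm
      have hne := pow_sub_neg_one_pow_ne_zero hq n.succ_ne_zero
      rw [Nat.succ_eq_add_one, hm, pow_mul, pow_mul] at hne
      rw [hm, pow_mul (q : ℤ), pow_mul (-1 : ℤ),
        rPartZ_pow_sub_pow hr hodd ((hdvd_iff d).2 dvd_rfl) (hrq d) hm0 hne, ← hquot,
        Nat.factorial_succ, Nat.cast_mul, rPartZ_mul r (by positivity) (by positivity)]
      ring
    · rw [rPartZ_eq_one_of_not_dvd (mt (hdvd_iff (n + 1)).1 h), mul_one, add_zero]
end
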